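/- arXiv:1710.03841 — 2 statements merged into one kernel-verified Lean document; each statement's English description precedes it below -/
import Mathlib

section
/- (Pressure theorem) Let E be a compact metric space, Ω = E^ℕ, p a fully supported Borel probability measure on E, f ∈ C(Ω), and L_f the Ruelle operator. Then there exists a real number P(f), called the pressure of f, such that sup_{x∈Ω} | (1/n) log (L_f^n 1)(x) − P(f) | → 0 as n → ∞; that is, n^{-1} log L_f^n(1) converges uniformly on Ω to the constant P(f). -/
open MeasureTheory Filter Topology

noncomputable section

/-- The sequence `(a, x₁, x₂, …)` obtained by prepending `a` to `x`. -/
def cons {E : Type*} (a : E) (x : ℕ → E) : ℕ → E := fun n => Nat.casesOn n a x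

theorem continuous_cons_aux {E : Type*} [TopologicalSpace E] (x : ℕ → E) :
    Continuous (fun a : E => cons a x) := by
  refine continuous_pi fun n => ?_
  cases n with
  | zero => exact continuous_id
  | succ n => exact continuous_const

theorem unif_aux {E : Type*} [MetricSpace E] [CompactSpace E] (f : C(ℕ → E, ℝ))
    (ε : ℝ) (hε : 0 < ε) :
    ∃ N : ℕ, ∀ x y : ℕ → E, (∀ i < N, x i = y i) → |f x - f y| < ε := by
  have hu : UniformContinuous f := CompactSpace.uniformContinuous_of_continuous f.continuous
  have hs : {q : (ℕ → E) × (ℕ → E) | |f q.1 - f q.2| < ε} ∈ uniformity (ℕ → E) := by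
    have := hu (Metric.dist_mem_uniformity hε)
    simpa [Real.dist_eq] using this
  have hF : (⨅ N : ℕ, 𝓟 {q : (ℕ → E) × (ℕ → E) | ∀ i < N, q.1 i = q.2 i})
      ≤ uniformity (ℕ → E) := by
    rw [Pi.uniformity]
    refine le_iInf fun i => iInf_le_of_le (i + 1) ?_
    rw [← Filter.map_le_iff_le_comap, Filter.map_principal]
    refine le_trans ?_ refl_le_uniformity
    rw [Filter.principal_mono]
    rintro _ ⟨q, hq, rfl⟩
    exact hq i (Nat.lt_succ_self i)
  have h2 := hF hs
  rw [Filter.mem_iInf_of_directed] at h2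
  · obtain ⟨N, hN⟩ := h2
    rw [Filter.mem_principal] at hN
    exact ⟨N, fun x y h => hN (a := (x, y)) h⟩
  · intro a b
    refine ⟨max a b, ?_, ?_⟩
    · exact Filter.principal_mono.2 fun q hq i hi => hq i (lt_max_of_lt_left hi)
    · exact Filter.principal_mono.2 fun q hq i hi => hq i (lt_max_of_lt_right hi)

section Aux

variable {E : Type*} [MetricSpace E] [CompactSpace E] [MeasurableSpace E] [BorelSpace E]
    (p : Measure E) [IsProbabilityMeasure p]
    (f : C(ℕ → E, ℝ))
    (T : C(ℕ → E, ℝ) →L[ℝ] C(ℕ → E, ℝ))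

theorem integrable_aux (φ : C(ℕ → E, ℝ)) (x : ℕ → E) :
    Integrable (fun a => Real.exp (f (cons a x)) * φ (cons a x)) p := by
  have hc := continuous_cons_aux x
  refine Continuous.integrable_of_hasCompactSupport ?_ (HasCompactSupport.of_compactSpace _)
  exact (Real.continuous_exp.comp (f.continuous.comp hc)).mul (φ.continuous.comp hc)

theorem compare_aux
    (hT : ∀ (φ : C(ℕ → E, ℝ)) (x : ℕ → E),
      T φ x = ∫ a, Real.exp (f (cons a x)) * φ (cons a x) ∂p)
    (φ ψ : C(ℕ → E, ℝ)) (x y : ℕ → E) (c : ℝ)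
    (h : ∀ a, Real.exp (f (cons a x)) * φ (cons a x)
      ≤ c * (Real.exp (f (cons a y)) * ψ (cons a y))) : T φ x ≤ c * T ψ y := by
  rw [hT, hT, ← integral_const_mul]
  exact integral_mono (integrable_aux p f φ x) ((integrable_aux p f ψ y).const_mul c) h

theorem lower_aux
    (hT : ∀ (φ : C(ℕ → E, ℝ)) (x : ℕ → E),
      T φ x = ∫ a, Real.exp (f (cons a x)) * φ (cons a x) ∂p)
    (n : ℕ) (x : ℕ → E) : Real.exp (-(n * ‖f‖)) ≤ (T ^ n) 1 x := by
  induction n generalizing x with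
  | zero => simp
  | succ n ih =>
    rw [pow_succ', mul_apply_eq_comp, hT]
    have : Real.exp (-(((n + 1 : ℕ) : ℝ) * ‖f‖))
        = ∫ _a : E, Real.exp (-(((n + 1 : ℕ) : ℝ) * ‖f‖)) ∂p := by simp
    rw [this]
    refine integral_mono (integrable_const _) (integrable_aux p f _ x) fun a => ?_
    have h1 : -‖f‖ ≤ f (cons a x) := (abs_le.1 (f.norm_coe_le_norm (cons a x))).1
    calc Real.exp (-(((n + 1 : ℕ) : ℝ) * ‖f‖)) = Real.exp (-‖f‖) * Real.exp (-(n * ‖f‖)) := by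
          rw [← Real.exp_add]; push_cast; ring_nf
      _ ≤ _ := mul_le_mul (Real.exp_le_exp.2 h1) (ih _) (Real.exp_pos _).le (Real.exp_pos _).le

theorem pos_aux
    (hT : ∀ (φ : C(ℕ → E, ℝ)) (x : ℕ → E),
      T φ x = ∫ a, Real.exp (f (cons a x)) * φ (cons a x) ∂p)
    (n : ℕ) (x : ℕ → E) : 0 < (T ^ n) 1 x :=
  (Real.exp_pos _).trans_le (lower_aux p f T hT n x)

theorem mono_aux
    (hT : ∀ (φ : C(ℕ → E, ℝ)) (x : ℕ → E),
      T φ x = ∫ a, Real.exp (f (cons a x)) * φ (cons a x) ∂p)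
    (n : ℕ) (φ : C(ℕ → E, ℝ)) (c : ℝ) (h : ∀ x, φ x ≤ c) (x : ℕ → E) :
    (T ^ n) φ x ≤ c * (T ^ n) 1 x := by
  induction n generalizing x with
  | zero => simpa using h x
  | succ n ih =>
    rw [pow_succ', mul_apply_eq_comp, mul_apply_eq_comp]
    refine compare_aux p f T hT _ _ x x c fun a => ?_
    have := mul_le_mul_of_nonneg_left (ih (cons a x)) (Real.exp_pos (f (cons a x))).le
    linarith

theorem osc_aux
    (hT : ∀ (φ : C(ℕ → E, ℝ)) (x : ℕ → E),
      T φ x = ∫ a, Real.exp (f (cons a x)) * φ (cons a x) ∂p)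
    (v : ℕ → ℝ)
    (hv : ∀ k (x y : ℕ → E), (∀ i < k, x i = y i) → f x ≤ f y + v k) (n k : ℕ)
    (x y : ℕ → E) (hxy : ∀ i < k, x i = y i) :
    (T ^ n) 1 x ≤ Real.exp (∑ j ∈ Finset.range n, v (k + 1 + j)) * (T ^ n) 1 y := by
  induction n generalizing x y k with
  | zero => simp
  | succ n ih =>
    rw [pow_succ', mul_apply_eq_comp]
    refine compare_aux p f T hT _ _ x y _ fun a => ?_
    have hc : ∀ i < k + 1, cons a x i = cons a y i := by
      intro i hi
      cases i with
      | zero => rfl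
      | succ i => exact hxy i (by omega)
    have h1 := Real.exp_le_exp.2 (hv (k + 1) _ _ hc)
    have h2 := ih (k + 1) _ _ hc
    have h3 := mul_le_mul h1 h2 (pos_aux p f T hT n _).le (Real.exp_pos _).le
    refine h3.trans (le_of_eq ?_)
    rw [Finset.sum_range_succ', Real.exp_add, Real.exp_add]
    have : ∀ j, k + 1 + 1 + j = k + 1 + (j + 1) := fun j => by omega
    simp only [this, add_zero]
    ring

theorem osc_eps_aux
    (hT : ∀ (φ : C(ℕ → E, ℝ)) (x : ℕ → E),
      T φ x = ∫ a, Real.exp (f (cons a x)) * φ (cons a x) ∂p)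
    (ε : ℝ) (hε : 0 < ε) : ∃ C : ℝ, 0 ≤ C ∧ ∀ (n : ℕ) (x y : ℕ → E),
    (T ^ n) 1 x ≤ Real.exp (C + n * ε) * (T ^ n) 1 y := by
  obtain ⟨N, hN⟩ := unif_aux f ε hε
  refine ⟨N * (2 * ‖f‖), by positivity, fun n x y => ?_⟩
  have h := osc_aux p f T hT (fun k => ε + if k < N then 2 * ‖f‖ else 0) ?_ n 0 x y (by simp)
  · refine h.trans (mul_le_mul_of_nonneg_right (Real.exp_le_exp.2 ?_) (pos_aux p f T hT n y).le)
    rw [Finset.sum_add_distrib, Finset.sum_const, Finset.card_range, nsmul_eq_mul,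
      ← Finset.sum_filter, Finset.sum_const, nsmul_eq_mul, add_comm]
    have : (Finset.filter (fun j => 0 + 1 + j < N) (Finset.range n)).card ≤ N := by
      calc _ ≤ (Finset.range N).card := Finset.card_le_card (by
            intro j hj
            simp only [Finset.mem_filter, Finset.mem_range] at hj ⊢
            omega)
        _ = N := Finset.card_range N
    gcongr
  · intro k x y hxy
    split_ifs with hk
    · have h1 := (abs_le.1 (f.norm_coe_le_norm x)).2
      have h2 := (abs_le.1 (f.norm_coe_le_norm y)).1
      linarith
    · have := (abs_lt.1 (hN x y fun i hi => hxy i (by omega))).2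
      linarith

end Aux

/-- **Pressure theorem.** There is a real number `P(f)` such that
`n⁻¹ log (L_f^n 1)` converges uniformly on `Ω` to the constant `P(f)`. -/
theorem pressure_exists
    {E : Type*} [MetricSpace E] [CompactSpace E] [MeasurableSpace E] [BorelSpace E]
    (p : Measure E) [IsProbabilityMeasure p]
    (hp : ∀ U : Set E, IsOpen U → U.Nonempty → 0 < p U)
    (f : C(ℕ → E, ℝ))
    (T : C(ℕ → E, ℝ) →L[ℝ] C(ℕ → E, ℝ))
    (hT : ∀ (φ : C(ℕ → E, ℝ)) (x : ℕ → E),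
      T φ x = ∫ a, Real.exp (f (cons a x)) * φ (cons a x) ∂p) :
    ∃ P : ℝ,
      TendstoUniformly (fun (n : ℕ) (x : ℕ → E) => Real.log ((T ^ n) 1 x) / n)
        (fun _ => P) atTop := by
  have hE : Nonempty E := by
    by_contra h
    rw [not_nonempty_iff] at h
    have h1 := measure_univ (μ := p)
    simp [Set.univ_eq_empty_iff.2 h] at h1
  obtain ⟨e⟩ := hE
  have hpos := pos_aux p f T hT
  have hle : ∀ n x, (T ^ n) 1 x ≤ ‖(T ^ n) 1‖ := fun n x =>
    (le_abs_self _).trans (ContinuousMap.norm_coe_le_norm ((T ^ n) 1) x)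
  have hnpos : ∀ n, 0 < ‖(T ^ n) 1‖ := fun n => (hpos n fun _ => e).trans_le (hle n _)
  have hnle : ∀ n (c : ℝ), (∀ x, (T ^ n) 1 x ≤ c) → ‖(T ^ n) 1‖ ≤ c := by
    intro n c h
    refine (ContinuousMap.norm_le _ ((hpos n fun _ => e).le.trans (h _))).2 fun x => ?_
    rw [Real.norm_eq_abs, abs_of_pos (hpos n x)]
    exact h x
  have hsub : Subadditive (fun n => Real.log ‖(T ^ n) 1‖) := by
    intro m n
    dsimp only
    rw [← Real.log_mul (hnpos m).ne' (hnpos n).ne']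
    refine Real.log_le_log (hnpos _) (hnle _ _ fun x => ?_)
    rw [pow_add, mul_apply_eq_comp, mul_comm]
    exact (mono_aux p f T hT m _ _ (hle n) x).trans
      (mul_le_mul_of_nonneg_left (hle m x) (norm_nonneg _))
  have hbdd : BddBelow (Set.range fun n : ℕ => Real.log ‖(T ^ n) 1‖ / n) := by
    refine ⟨-‖f‖, ?_⟩
    rintro _ ⟨n, rfl⟩
    dsimp only
    rcases Nat.eq_zero_or_pos n with rfl | hn
    · simp
    · have hn' : (0 : ℝ) < n := by exact_mod_cast hn
      rw [le_div_iff₀ hn']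
      have := (Real.le_log_iff_exp_le (hnpos n)).2
        ((lower_aux p f T hT n fun _ => e).trans (hle n _))
      linarith
  refine ⟨hsub.lim, ?_⟩
  rw [Metric.tendstoUniformly_iff]
  intro ε hε
  obtain ⟨C, hC, hosc⟩ := osc_eps_aux p f T hT (ε / 3) (by positivity)
  have h1 := (Metric.tendsto_nhds.1 (hsub.tendsto_lim hbdd)) (ε / 3) (by positivity)
  have h2 := (tendsto_const_div_atTop_nhds_zero_nat C).eventually_lt_const
    (show (0 : ℝ) < ε / 3 by positivity)
  filter_upwards [h1, h2, eventually_gt_atTop 0] with n hn1 hn2 hn x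
  have hn' : (0 : ℝ) < n := by exact_mod_cast hn
  have hup : Real.log ((T ^ n) 1 x) / n ≤ Real.log ‖(T ^ n) 1‖ / n :=
    div_le_div_of_nonneg_right (Real.log_le_log (hpos n x) (hle n x)) hn'.le
  have hlo : Real.log ‖(T ^ n) 1‖ / n ≤ C / n + ε / 3 + Real.log ((T ^ n) 1 x) / n := by
    have := Real.log_le_log (hnpos n) (hnle n _ fun y => hosc n y x)
    rw [Real.log_mul (Real.exp_pos _).ne' (hpos n x).ne', Real.log_exp] at this
    calc _ ≤ _ := div_le_div_of_nonneg_right this hn'.le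
      _ = _ := by field_simp
  rw [Real.dist_eq, abs_lt] at hn1 ⊢
  constructor <;> linarith [hn1.1, hn1.2]
end
end

section
/- Let E be a compact metric space, Ω = E^ℕ, p a fully supported Borel probability measure on E, f ∈ C(Ω), L_f the Ruelle operator, and P(f) the pressure of f. Then the Gelfand limit of L_f exists and equals exp(P(f)): the operator norms satisfy ‖L_f^n‖^{1/n} → exp(P(f)) as n → ∞. In particular the spectral radius λ_f of L_f on C(Ω) equals exp(P(f)) and satisfies λ_f ≥ exp(−‖f‖_∞) > 0. -/
open MeasureTheory Filter Topology

noncomputable section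

section Helpers

variable {E : Type*} [MetricSpace E] [CompactSpace E] [MeasurableSpace E] [BorelSpace E]

theorem cons_continuous_left (x : ℕ → E) : Continuous fun a : E => cons a x := by
  refine continuous_pi fun n => ?_
  cases n with
  | zero => exact continuous_id
  | succ k => exact continuous_const

theorem ruelle_integrable (p : Measure E) [IsProbabilityMeasure p]
    (f φ : C(ℕ → E, ℝ)) (x : ℕ → E) :
    Integrable (fun a => Real.exp (f (cons a x)) * φ (cons a x)) p := by
  have h : Continuous (fun a => Real.exp (f (cons a x)) * φ (cons a x)) := by
    have := cons_continuous_left x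
    fun_prop
  exact h.integrable_of_hasCompactSupport (HasCompactSupport.of_compactSpace _)

theorem ruelle_mono (p : Measure E) [IsProbabilityMeasure p]
    (f : C(ℕ → E, ℝ))
    (T : C(ℕ → E, ℝ) →L[ℝ] C(ℕ → E, ℝ))
    (hT : ∀ (φ : C(ℕ → E, ℝ)) (x : ℕ → E),
      T φ x = ∫ a, Real.exp (f (cons a x)) * φ (cons a x) ∂p)
    (φ ψ : C(ℕ → E, ℝ)) (h : φ ≤ ψ) : T φ ≤ T ψ := by
  refine ContinuousMap.le_def.2 fun x => ?_
  rw [hT, hT]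
  refine integral_mono (ruelle_integrable p f φ x) (ruelle_integrable p f ψ x) fun a => ?_
  exact mul_le_mul_of_nonneg_left (ContinuousMap.le_def.1 h _) (Real.exp_pos _).le

theorem pow_mono_of_mono {X : Type*} [TopologicalSpace X] [CompactSpace X]
    (T : C(X, ℝ) →L[ℝ] C(X, ℝ)) (hm : ∀ φ ψ, φ ≤ ψ → T φ ≤ T ψ) (n : ℕ) :
    ∀ φ ψ, φ ≤ ψ → (T ^ n) φ ≤ (T ^ n) ψ := by
  induction n with
  | zero => intro φ ψ h; simpa using h
  | succ k ih =>
    intro φ ψ h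
    rw [pow_succ']
    exact hm _ _ (ih _ _ h)

theorem ruelle_pow_lower (p : Measure E) [IsProbabilityMeasure p]
    (f : C(ℕ → E, ℝ))
    (T : C(ℕ → E, ℝ) →L[ℝ] C(ℕ → E, ℝ))
    (hT : ∀ (φ : C(ℕ → E, ℝ)) (x : ℕ → E),
      T φ x = ∫ a, Real.exp (f (cons a x)) * φ (cons a x) ∂p)
    (n : ℕ) : ∀ x, Real.exp (-‖f‖) ^ n ≤ (T ^ n) 1 x := by
  induction n with
  | zero => intro x; simp
  | succ k ih =>
    intro x
    rw [pow_succ' T]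
    change _ ≤ T ((T ^ k) 1) x
    rw [hT]
    have : ∫ _a : E, Real.exp (-‖f‖) ^ (k+1) ∂p = Real.exp (-‖f‖) ^ (k+1) := by simp
    rw [← this]
    refine integral_mono (integrable_const _) (ruelle_integrable p f _ x) fun a => ?_
    change Real.exp (-‖f‖) ^ (k+1) ≤ Real.exp (f (cons a x)) * ((T ^ k) 1) (cons a x)
    rw [pow_succ']
    refine mul_le_mul ?_ (ih _) (by positivity) (Real.exp_pos _).le
    apply Real.exp_le_exp.2
    have := f.norm_coe_le_norm (cons a x)
    rw [Real.norm_eq_abs] at this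
    linarith [neg_abs_le (f (cons a x))]

theorem norm_pow_eq {X : Type*} [TopologicalSpace X] [CompactSpace X] [Nonempty X]
    (T : C(X, ℝ) →L[ℝ] C(X, ℝ)) (hm : ∀ φ ψ, φ ≤ ψ → T φ ≤ T ψ) :
    ‖T‖ = ‖T 1‖ := by
  apply le_antisymm
  · refine T.opNorm_le_bound (norm_nonneg _) fun φ => ?_
    refine (ContinuousMap.norm_le _ (by positivity)).2 fun x => ?_
    have h1 : φ ≤ ‖φ‖ • (1 : C(X, ℝ)) := by
      refine ContinuousMap.le_def.2 fun y => ?_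
      have := φ.norm_coe_le_norm y
      simp only [ContinuousMap.smul_apply, ContinuousMap.one_apply, smul_eq_mul, mul_one]
      exact (le_abs_self _).trans this
    have h2 : (-‖φ‖) • (1 : C(X, ℝ)) ≤ φ := by
      refine ContinuousMap.le_def.2 fun y => ?_
      have := φ.norm_coe_le_norm y
      simp only [ContinuousMap.smul_apply, ContinuousMap.one_apply, smul_eq_mul, mul_one]
      exact (abs_le.1 this).1
    have h3 := ContinuousMap.le_def.1 (hm _ _ h1) x
    have h4 := ContinuousMap.le_def.1 (hm _ _ h2) x
    rw [map_smul] at h3 h4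
    simp only [ContinuousMap.smul_apply, smul_eq_mul] at h3 h4
    have h5 := (le_abs_self _).trans ((T 1).norm_coe_le_norm x)
    rw [Real.norm_eq_abs, abs_le]
    constructor <;> nlinarith [norm_nonneg φ]
  · have := T.le_opNorm 1
    simpa using this

theorem spec_pow_le {A : Type*} [NormedRing A] [NormedAlgebra ℝ A] [CompleteSpace A]
    [NormOneClass A] (a : A) (k : ℝ) (hk : k ∈ spectrum ℝ a) (n : ℕ) : ‖k‖ ^ n ≤ ‖a ^ n‖ := by
  rw [← norm_pow]
  have := spectrum.norm_le_norm_mul_of_mem (spectrum.pow_mem_pow a n hk)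
  simpa using this

theorem resolvent_continuousAt' {A : Type*} [NormedRing A] [NormedAlgebra ℝ A] [CompleteSpace A]
    (a : A) (k : ℝ) (hk : k ∈ resolventSet ℝ a) : ContinuousAt (resolvent a) k :=
  HasDerivAt.continuousAt (spectrum.hasDerivAt_resolvent_const_left hk)

theorem resolvent_eventually {A : Type*} [NormedRing A] [NormedAlgebra ℝ A] [CompleteSpace A]
    (a : A) (k : ℝ) (hk : k ∈ resolventSet ℝ a) : ∀ᶠ l in nhds k, l ∈ resolventSet ℝ a :=
  (spectrum.isOpen_resolventSet a).mem_nhds hk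

theorem resolvent_eventually_clm {V : Type*} [NormedAddCommGroup V] [NormedSpace ℝ V]
    [CompleteSpace V] (T : V →L[ℝ] V) (k : ℝ) (hk : k ∈ resolventSet ℝ T) :
    ∀ᶠ l in nhds k, l ∈ resolventSet ℝ T :=
  resolvent_eventually T k hk

theorem resolvent_apply_continuousAt {V : Type*} [NormedAddCommGroup V] [NormedSpace ℝ V]
    [CompleteSpace V] (T : V →L[ℝ] V) (v : V) (k : ℝ) (hk : k ∈ resolventSet ℝ T) :
    ContinuousAt (fun l => resolvent T l v) k := by
  have h1 : ContinuousAt (resolvent T) k := resolvent_continuousAt' T k hk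
  exact h1.clm_apply continuousAt_const

theorem resolvent_apply_eq {V : Type*} [NormedAddCommGroup V] [NormedSpace ℝ V]
    (T : V →L[ℝ] V) (v : V) (l : ℝ) (hl : l ∈ resolventSet ℝ T) :
    l • resolvent T l v - T (resolvent T l v) = v := by
  have h1 : (algebraMap ℝ (V →L[ℝ] V) l - T) * resolvent T l = 1 :=
    Ring.mul_inverse_cancel _ hl
  have h2 := congrArg (fun S : V →L[ℝ] V => S v) h1
  simpa [Algebra.algebraMap_eq_smul_one] using h2

end Helpers

set_option maxHeartbeats 2000000

/-- The Gelfand limit `‖L_f^n‖^{1/n}` exists and equals `exp(P(f))`; in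
particular the spectral radius `λ_f` of `L_f` on `C(Ω)` equals `exp(P(f))` and satisfies
`λ_f ≥ exp(−‖f‖) > 0`. -/
theorem gelfand_limit_eq_exp_pressure
    {E : Type*} [MetricSpace E] [CompactSpace E] [MeasurableSpace E] [BorelSpace E]
    (p : Measure E) [IsProbabilityMeasure p]
    (hp : ∀ U : Set E, IsOpen U → U.Nonempty → 0 < p U)
    (f : C(ℕ → E, ℝ))
    (T : C(ℕ → E, ℝ) →L[ℝ] C(ℕ → E, ℝ))
    (hT : ∀ (φ : C(ℕ → E, ℝ)) (x : ℕ → E),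
      T φ x = ∫ a, Real.exp (f (cons a x)) * φ (cons a x) ∂p)
    (P : ℝ)
    (hP : TendstoUniformly (fun (n : ℕ) (x : ℕ → E) => Real.log ((T ^ n) 1 x) / n)
      (fun _ => P) atTop) :
    Tendsto (fun n : ℕ => ‖T ^ n‖ ^ ((1 : ℝ) / n)) atTop (nhds (Real.exp P)) ∧
    spectralRadius ℝ T = ENNReal.ofReal (Real.exp P) ∧
    Real.exp (-‖f‖) ≤ Real.exp P ∧ 0 < Real.exp P := by
  have hE : Nonempty E := by
    by_contra h
    rw [not_nonempty_iff] at h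
    have h1 : p Set.univ = 1 := measure_univ
    rw [Set.univ_eq_empty_iff.2 h] at h1
    simp at h1
  have hm := ruelle_mono p f T hT
  have hlow := ruelle_pow_lower p f T hT
  have hpos : ∀ n x, 0 < (T ^ n) 1 x := fun n x => lt_of_lt_of_le (by positivity) (hlow n x)
  have hnorm : ∀ n, ∃ x, ‖T ^ n‖ = (T ^ n) 1 x := by
    intro n
    rw [norm_pow_eq _ (pow_mono_of_mono T hm n)]
    obtain ⟨x, -, hx⟩ := isCompact_univ.exists_isMaxOn (Set.univ_nonempty (α := ℕ → E))
      ((T ^ n) 1).continuous.continuousOn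
    refine ⟨x, le_antisymm ?_ ((le_abs_self _).trans (((T ^ n) 1).norm_coe_le_norm x))⟩
    refine (ContinuousMap.norm_le _ (hpos n x).le).2 fun y => ?_
    rw [Real.norm_eq_abs, abs_of_pos (hpos n y)]
    exact hx (Set.mem_univ y)
  choose z hz using hnorm
  have hlim : Tendsto (fun n : ℕ => Real.log ((T ^ n) 1 (z n)) / n) atTop (nhds P) := by
    rw [Metric.tendsto_nhds]
    intro ε hε
    filter_upwards [Metric.tendstoUniformly_iff.1 hP ε hε] with n hn
    rw [dist_comm]
    exact hn (z n)
  have hgel : Tendsto (fun n : ℕ => ‖T ^ n‖ ^ ((1 : ℝ) / n)) atTop (nhds (Real.exp P)) := by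
    refine ((Real.continuous_exp.tendsto P).comp hlim).congr fun n => ?_
    rw [hz n, Real.rpow_def_of_pos (hpos n _)]
    simp [div_eq_mul_inv]
  have hPf : -‖f‖ ≤ P := by
    refine ge_of_tendsto hlim ?_
    filter_upwards [eventually_gt_atTop 0] with n hn
    have hn' : (0 : ℝ) < n := by exact_mod_cast hn
    rw [le_div_iff₀ hn']
    have := Real.log_le_log (by positivity) (hlow n (z n))
    rw [Real.log_pow, Real.log_exp] at this
    linarith
  refine ⟨hgel, ?_, Real.exp_le_exp.2 hPf, Real.exp_pos _⟩
  set r := Real.exp P with hr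
  have hr0 : 0 < r := Real.exp_pos P
  -- growth upper bound
  have hsmall : ∀ l, r < l → Tendsto (fun n : ℕ => ‖T ^ n‖ / l ^ n) atTop (nhds 0) := by
    intro l hl
    obtain ⟨m, hm1, hm2⟩ := exists_between hl
    have hm0 : 0 < m := hr0.trans hm1
    have hl0 : 0 < l := hr0.trans hl
    have h1 : Tendsto (fun n : ℕ => (m / l) ^ n) atTop (nhds 0) :=
      tendsto_pow_atTop_nhds_zero_of_lt_one (by positivity) ((div_lt_one hl0).2 hm2)
    refine squeeze_zero' (Eventually.of_forall fun n => by positivity) ?_ h1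
    filter_upwards [hgel.eventually_lt_const hm1, eventually_gt_atTop 0] with n hn hn0
    rw [div_pow]
    gcongr
    have h2 : (‖T ^ n‖ ^ ((1 : ℝ) / n)) ^ n ≤ m ^ n := by
      gcongr
    have h3 := Real.rpow_inv_natCast_pow (x := ‖T ^ n‖) (ContinuousLinearMap.opNorm_nonneg (T ^ n)) hn0.ne'
    rw [one_div] at h2
    exact h3.symm.le.trans h2
  apply le_antisymm
  · refine iSup₂_le fun k hk => ?_
    by_contra hcon
    push Not at hcon
    have hkr : r < ‖k‖ := by
      rw [← ENNReal.ofReal_lt_ofReal_iff_of_nonneg hr0.le]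
      rwa [ofReal_norm, ← enorm_eq_nnnorm] at *
    have h0 := hsmall _ hkr
    have h1 : ∀ n : ℕ, 1 ≤ ‖T ^ n‖ / ‖k‖ ^ n := by
      intro n
      rw [one_le_div (pow_pos (hr0.trans hkr) n)]
      exact spec_pow_le T k hk n
    have := ge_of_tendsto' h0 h1
    linarith
  · suffices hmem : r ∈ spectrum ℝ T by
      have h := le_iSup₂ (f := fun k (_ : k ∈ spectrum ℝ T) => (‖k‖₊ : ENNReal)) r hmem
      refine le_trans (le_of_eq ?_) h
      rw [← enorm_eq_nnnorm, ← ofReal_norm, Real.norm_of_nonneg hr0.le]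
    by_contra hmem
    have hres : r ∈ resolventSet ℝ T := by
      by_contra h
      exact hmem h
    let g : ℝ → C(ℕ → E, ℝ) := fun l => resolvent T l 1
    have hgc : ContinuousAt g r := by
      exact resolvent_apply_continuousAt T 1 r hres
    have hopen : ∀ᶠ l in nhds r, l ∈ resolventSet ℝ T :=
      resolvent_eventually_clm T r hres
    have heq : ∀ l ∈ resolventSet ℝ T, ∀ x, l * g l x = 1 + T (g l) x := by
      intro l hl x
      have h1 := resolvent_apply_eq T 1 l hl
      have h2 := congrArg (fun S : C(ℕ → E, ℝ) => S x) h1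
      change l * g l x - T (g l) x = 1 at h2
      linarith
    -- nonnegativity above r
    have hnn : ∀ l ∈ resolventSet ℝ T, r < l → ∀ x, 0 ≤ g l x := by
      intro l hl hrl x
      have hl0 : 0 < l := hr0.trans hrl
      have hit : ∀ n : ℕ, (T ^ n) (g l) ≤ l ^ n • g l := by
        intro n
        induction n with
        | zero => simp
        | succ k ih =>
          have h1 := hm _ _ ih
          rw [pow_succ' T]
          refine le_trans (show (T * T ^ k) (g l) ≤ T (l ^ k • g l) from h1) ?_
          rw [map_smul]
          refine ContinuousMap.le_def.2 fun y => ?_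
          have := heq l hl y
          simp only [ContinuousMap.smul_apply, smul_eq_mul, pow_succ]
          have h2 : 0 < l ^ k := by positivity
          nlinarith
      have hb : ∀ n : ℕ, -(‖T ^ n‖ / l ^ n * ‖g l‖) ≤ g l x := by
        intro n
        have h2 : 0 < l ^ n := by positivity
        have h1 := ContinuousMap.le_def.1 (hit n) x
        simp only [ContinuousMap.smul_apply, smul_eq_mul] at h1
        have h3 := (((T ^ n) (g l)).norm_coe_le_norm x).trans ((T ^ n).le_opNorm (g l))
        have h4 := (abs_le.1 h3).1
        rw [div_mul_eq_mul_div, ← neg_div, div_le_iff₀ h2]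
        linarith
      have h5 := ((hsmall l hrl).mul_const ‖g l‖).neg
      simp only [zero_mul, neg_zero] at h5
      exact le_of_tendsto' h5 hb
    have hnr : 0 ≤ g r := by
      refine ContinuousMap.le_def.2 fun x => ?_
      have h1 : Tendsto (fun l => g l x) (nhdsWithin r (Set.Ioi r)) (nhds (g r x)) :=
        (((continuous_eval_const (F := C(ℕ → E, ℝ)) x).tendsto _).comp hgc.tendsto).mono_left
          nhdsWithin_le_nhds
      refine ge_of_tendsto h1 ?_
      filter_upwards [nhdsWithin_le_nhds hopen, self_mem_nhdsWithin] with l hl hl2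
      exact hnn l hl hl2 x
    have hgr : ∀ x, 1 / r ≤ g r x := by
      intro x
      have h1 := heq r hres x
      have h2 := ContinuousMap.le_def.1 (hm _ _ hnr) x
      rw [map_zero] at h2
      rw [div_le_iff₀ hr0]
      simp only [ContinuousMap.zero_apply] at h2
      linarith
    obtain ⟨l, ⟨hl, hlg, hl0⟩, hlr⟩ : ∃ l, (l ∈ resolventSet ℝ T ∧ dist (g l) (g r) < 1 / (2 * r)
        ∧ 0 < l) ∧ l < r := by
      have h1 : ∀ᶠ l in nhds r, l ∈ resolventSet ℝ T ∧ dist (g l) (g r) < 1 / (2 * r) ∧ 0 < l :=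
        hopen.and (((Metric.tendsto_nhds.1 hgc.tendsto) _ (by positivity)).and
          (lt_mem_nhds hr0))
      exact ((h1.filter_mono nhdsWithin_le_nhds).and
        (self_mem_nhdsWithin : Set.Iio r ∈ nhdsWithin r (Set.Iio r))).exists
    have hgl : ∀ x, 1 / (2 * r) ≤ g l x := by
      intro x
      have h1 := (ContinuousMap.dist_apply_le_dist (f := g l) (g := g r) x).trans_lt hlg
      rw [Real.dist_eq, abs_lt] at h1
      have h2 := hgr x
      have h3 : 1 / r = 1 / (2 * r) + 1 / (2 * r) := by field_simp; norm_num
      linarith [h1.1]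
    have hit : ∀ n : ℕ, (T ^ n) (g l) ≤ l ^ n • g l := by
      intro n
      induction n with
      | zero => simp
      | succ k ih =>
        have h1 := hm _ _ ih
        rw [pow_succ' T]
        refine le_trans (show (T * T ^ k) (g l) ≤ T (l ^ k • g l) from h1) ?_
        rw [map_smul]
        refine ContinuousMap.le_def.2 fun y => ?_
        have := heq l hl y
        simp only [ContinuousMap.smul_apply, smul_eq_mul, pow_succ]
        have h2 : 0 < l ^ k := by positivity
        nlinarith
    have hC : ∀ n : ℕ, (T ^ n) 1 (z n) ≤ l ^ n * (2 * r * ‖g l‖) := by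
      intro n
      have h1 : (1 : C(ℕ → E, ℝ)) ≤ (2 * r) • g l := by
        refine ContinuousMap.le_def.2 fun y => ?_
        have := hgl y
        rw [div_le_iff₀ (by positivity)] at this
        simp only [ContinuousMap.smul_apply, ContinuousMap.one_apply, smul_eq_mul]
        linarith
      have h2 := ContinuousMap.le_def.1 (pow_mono_of_mono T hm n _ _ h1) (z n)
      rw [map_smul] at h2
      have h3 := ContinuousMap.le_def.1 (hit n) (z n)
      simp only [ContinuousMap.smul_apply, smul_eq_mul] at h2 h3
      have h4 := (le_abs_self _).trans ((g l).norm_coe_le_norm (z n))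
      calc _ ≤ 2 * r * (l ^ n * g l (z n)) := h2.trans (by gcongr)
        _ ≤ 2 * r * (l ^ n * ‖g l‖) := by gcongr
        _ = _ := by ring
    set K := 2 * r * ‖g l‖ with hK
    have hKpos : 0 < K := by
      have := (hpos 0 (z 0)).trans_le (hC 0)
      simpa using this
    have hlim2 : Tendsto (fun n : ℕ => Real.log l + Real.log K / n) atTop (nhds (Real.log l)) := by
      simpa using (tendsto_const_nhds (x := Real.log l)).add
        (tendsto_const_div_atTop_nhds_zero_nat (Real.log K))
    have hfin : P ≤ Real.log l := by
      refine le_of_tendsto_of_tendsto hlim hlim2 ?_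
      filter_upwards [eventually_gt_atTop 0] with n hn
      have hn' : (0 : ℝ) < n := by exact_mod_cast hn
      have h1 := Real.log_le_log (hpos n (z n)) (hC n)
      rw [Real.log_mul (by positivity) hKpos.ne', Real.log_pow] at h1
      rw [div_le_iff₀ hn', add_mul, div_mul_cancel₀ _ hn'.ne']
      linarith
    have : r ≤ l := by
      rw [hr, ← Real.exp_log hl0]
      exact Real.exp_le_exp.2 hfin
    linarith
end
end
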